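/- Let L and H be restricted Lie algebras over a field F of characteristic p > 0 and let φ : u(L) → u(H) be an algebra isomorphism with φ(ω(L)) = ω(H). Then φ(D_n(L) + ω(L)^{n+1}) = D_n(H) + ω(H)^{n+1} for every positive integer n. -/

import Mathlib

open UniversalEnvelopingAlgebra

attribute [local instance 100] LieRing.ofAssociativeRing

/-- A restricted Lie algebra over a field `F` of characteristic `p`: a Lie algebra equipped
with a `p`-map `x ↦ x^[p]` satisfying Jacobson's identities.  The additive identity
`(x+y)^[p] = x^[p] + y^[p] + Σ sᵢ(x,y)` (with `sᵢ` the Jacobson polynomials) is expressed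
faithfully inside the universal enveloping algebra, where it reads
`ι((x+y)^[p]) - ι(x^[p]) - ι(y^[p]) = (ι x + ι y)^p - (ι x)^p - (ι y)^p`. -/
class RestrictedLieAlgebra (p : ℕ) (F : Type*) (L : Type*) [Field F]
    [LieRing L] [LieAlgebra F L] : Type _ where
  pOp : L → L
  pOp_smul : ∀ (a : F) (x : L), pOp (a • x) = a ^ p • pOp x
  ad_pOp : ∀ x y : L, ⁅pOp x, y⁆ = ((LieAlgebra.ad F L x) ^ p) y
  pOp_add : ∀ x y : L,
    ι F (pOp (x + y)) - ι F (pOp x) - ι F (pOp y)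
      = (ι F x + ι F y) ^ p - (ι F x) ^ p - (ι F y) ^ p

namespace RestrictedLieAlgebra

variable (p : ℕ) (F : Type*) [Field F]

section Defs

variable (L : Type*) [LieRing L] [LieAlgebra F L] [RestrictedLieAlgebra p F L]

/-- The `p`-map of a restricted Lie algebra. -/
abbrev pmap (x : L) : L := RestrictedLieAlgebra.pOp (p := p) (F := F) x

/-- The relation defining the restricted enveloping algebra as a quotient of the
universal enveloping algebra: `x^p = x^[p]` for all `x ∈ L`. -/
def uRel : UniversalEnvelopingAlgebra F L → UniversalEnvelopingAlgebra F L → Prop :=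
  fun a b => ∃ x : L, a = (ι F x) ^ p ∧ b = ι F (pmap p F L x)

/-- The restricted enveloping algebra `u(L)`: the quotient of the universal enveloping
algebra of `L` by the two-sided ideal generated by `{x^p - x^[p] : x ∈ L}`. -/
abbrev uEnv := RingQuot (uRel p F L)

/-- The canonical (linear) embedding `L → u(L)`. -/
def uemb : L →ₗ[F] uEnv p F L :=
  ((RingQuot.mkAlgHom F (uRel p F L)).toLinearMap).comp (ι F : L →ₗ⁅F⁆ _).toLinearMap

variable [Fact p.Prime]

/-- The augmentation map `ε : u(L) → F`, induced by `x ↦ 0` for `x ∈ L`. -/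
noncomputable def aug : uEnv p F L →ₐ[F] F :=
  RingQuot.liftAlgHom F
    ⟨(UniversalEnvelopingAlgebra.lift F) (0 : L →ₗ⁅F⁆ F), by
      rintro a b ⟨x, rfl, rfl⟩
      simp [UniversalEnvelopingAlgebra.lift_ι_apply,
        zero_pow (Nat.Prime.ne_zero (Fact.out : p.Prime))]⟩

/-- The augmentation ideal `ω(L)`, i.e. the kernel of the augmentation map, as a
subspace of `u(L)`. -/
noncomputable def omegaIdeal : Submodule F (uEnv p F L) :=
  LinearMap.ker (aug p F L).toLinearMap

/-- The image of `L` inside `u(L)`. -/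
def lSub : Submodule F (uEnv p F L) := LinearMap.range (uemb p F L)

end Defs

section Closure

variable {L : Type*} [LieRing L] [LieAlgebra F L] [RestrictedLieAlgebra p F L]

/-- The restricted subalgebra generated by a subset `S` of `L`: the smallest Lie
subalgebra containing `S` which is closed under the `p`-map. -/
def restrictedClosure (S : Set L) : LieSubalgebra F L :=
  sInf {K : LieSubalgebra F L | S ⊆ K ∧ ∀ x ∈ K, pmap p F L x ∈ K}

/-- For a subalgebra `N ⊆ L`, the restricted subalgebra `N^p` generated by all
`x^[p]`, `x ∈ N`. -/
def subPPow (K : LieSubalgebra F L) : LieSubalgebra F L :=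
  restrictedClosure p F (pmap p F L '' K)

end Closure

section PNilpotent

variable (L : Type*) [LieRing L] [LieAlgebra F L] [RestrictedLieAlgebra p F L]

/-- `L` is `p`-nilpotent if `L^{pˢ} = 0` for some `s`, where `L^p` denotes the restricted
subalgebra generated by all `x^[p]`. -/
def IsPNilpotent : Prop :=
  ∃ s : ℕ, (subPPow p F)^[s] (⊤ : LieSubalgebra F L) = ⊥

/-- The derived subalgebra `L' = γ₂(L)` as a submodule of `L`. -/
abbrev derivedSub : Submodule F L := (LieModule.lowerCentralSeries F L L 1).toSubmodule

/-- `L'_p`, the restricted subalgebra generated by `L'`, as a submodule. -/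
def derivedP : Submodule F L :=
  (restrictedClosure p F (derivedSub F L : Set L)).toSubmodule

/-- `L'^p + γ₃(L)`, as a submodule of `L`. -/
def mainIdeal : Submodule F L :=
  (subPPow p F (restrictedClosure p F (derivedSub F L : Set L))).toSubmodule
    ⊔ (LieModule.lowerCentralSeries F L L 2).toSubmodule

end PNilpotent

end RestrictedLieAlgebra

open scoped TensorProduct

namespace Multiset

variable {κ R : Type*}

theorem sum_antidiagonal_fst_eq_zero [NonAssocSemiring R] [DecidableEq κ] (s : Multiset κ)
    (h : Multiset κ → R) :
    (s.antidiagonal.map fun x => (if x.1 = 0 then 1 else 0) * h x.2).sum = h s := by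
  induction s using Multiset.induction_on generalizing h with
  | empty => simp
  | cons a s ih =>
    have := ih (fun t => h (a ::ₘ t))
    simpa [Multiset.map_map, Function.comp_def] using this

theorem sum_antidiagonal_fst_eq_singleton [NonAssocSemiring R] [DecidableEq κ] (i : κ)
    (s : Multiset κ) (h : Multiset κ → R) :
    (s.antidiagonal.map fun x => (if x.1 = {i} then 1 else 0) * h x.2).sum
      = s.count i * h (s.erase i) := by
  induction s using Multiset.induction_on generalizing h with
  | empty => simp
  | cons a s ih =>
    have h1 := ih (fun t => h (a ::ₘ t))
    have h2 := sum_antidiagonal_fst_eq_zero s h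
    rw [antidiagonal_cons, Multiset.map_add, Multiset.sum_add]
    simp only [Multiset.map_map, Function.comp_def, Prod.map_fst, Prod.map_snd, id, h1]
    by_cases ha : a = i
    · subst ha
      have h3 : ∀ t : Multiset κ, a ::ₘ t = {a} ↔ t = 0 := fun t => by
        rw [← Multiset.cons_zero, Multiset.cons_inj_right]
      simp only [h3, h2, Multiset.count_cons_self, Multiset.erase_cons_head]
      by_cases hs : a ∈ s
      · rw [Multiset.cons_erase hs]; push_cast; rw [add_mul, one_mul]
      · simp [Multiset.count_eq_zero_of_notMem hs]
    · have h3 : ∀ t : Multiset κ, a ::ₘ t ≠ {i} := fun t ht => ha <| by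
        have : a ∈ ({i} : Multiset κ) := ht ▸ Multiset.mem_cons_self a t
        simpa using this
      simp [h3, Multiset.count_cons_of_ne (Ne.symm ha), Multiset.erase_cons_tail s ha]

end Multiset

theorem LinearIndepOn.exists_dual {F A κ : Type*} [Field F] [AddCommGroup A] [Module F A]
    [DecidableEq κ] {v : κ → A} {S : Set κ} (h : LinearIndepOn F v S) {i : κ} (hi : i ∈ S) :
    ∃ f : A →ₗ[F] F, ∀ j ∈ S, f (v j) = if j = i then 1 else 0 := by
  obtain ⟨g, hg⟩ := (Finsupp.linearCombination F fun j : S => v j).exists_leftInverse_of_injective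
    (LinearMap.ker_eq_bot.mpr h)
  refine ⟨Finsupp.lapply ⟨i, hi⟩ ∘ₗ g, fun j hj => ?_⟩
  have := congrArg (fun k => k (Finsupp.single ⟨j, hj⟩ 1)) hg
  simp only [LinearMap.comp_apply, Finsupp.linearCombination_single, one_smul,
    LinearMap.id_apply] at this
  simp [this, Finsupp.single_apply]

namespace OrderedMonomial

variable {F A I : Type*} [Field F] [Ring A] [Algebra F A]

section Independence

variable [LinearOrder I]

/-- The product of the elements `b i`, `i ∈ s`, taken in increasing order of `i`. -/
def mon (b : I → A) (s : Multiset I) : A := (s.sort.map b).prod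

/-- Multisets in which every element occurs fewer than `p` times. -/
def IsTruncated (p : ℕ) (s : Multiset I) : Prop := ∀ i, s.count i < p

theorem IsTruncated.mono {p : ℕ} {s t : Multiset I} (h : IsTruncated p t) (hst : s ≤ t) :
    IsTruncated p s := fun i => (Multiset.count_le_of_le i hst).trans_lt (h i)

variable {b : I → A}

@[simp] theorem mon_zero : mon b 0 = 1 := by simp [mon]

@[simp] theorem mon_singleton (i : I) : mon b {i} = b i := by simp [mon]

theorem mon_cons {i : I} {s : Multiset I} (h : ∀ j ∈ s, i ≤ j) :
    mon b (i ::ₘ s) = b i * mon b s := by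
  simp [mon, Multiset.sort_cons _ _ _ h]

theorem comul_mon {Δ : A →ₐ[F] A ⊗[F] A} (hΔ : ∀ i, Δ (b i) = b i ⊗ₜ 1 + 1 ⊗ₜ b i)
    (s : Multiset I) :
    Δ (mon b s) = (s.antidiagonal.map fun x => mon b x.1 ⊗ₜ[F] mon b x.2).sum := by
  rw [← Multiset.sort_eq s (· ≤ ·)]
  have hs := Multiset.pairwise_sort s (· ≤ ·)
  generalize s.sort (· ≤ ·) = l at hs
  induction l with
  | nil => simp [Algebra.TensorProduct.one_def]
  | cons a l ih =>
    obtain ⟨ha, hl⟩ := List.pairwise_cons.mp hs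
    rw [← Multiset.cons_coe, mon_cons (by simpa using ha), map_mul, ih hl, hΔ,
      Multiset.antidiagonal_cons, Multiset.map_add, Multiset.sum_add, add_mul, add_comm]
    simp only [Multiset.map_map, Function.comp_def, Prod.map_fst, Prod.map_snd, id,
      ← Multiset.sum_map_mul_left]
    congr 2 <;> refine Multiset.map_congr rfl fun x hx => ?_ <;>
      rw [Multiset.mem_antidiagonal] at hx
    · rw [mon_cons (fun j hj => ha j (by
        rw [← Multiset.mem_coe, ← hx]; exact Multiset.mem_add.mpr (Or.inr hj)))]
      simp
    · rw [mon_cons (fun j hj => ha j (by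
        rw [← Multiset.mem_coe, ← hx]; exact Multiset.mem_add.mpr (Or.inl hj)))]
      simp

/-- Convolution with dual functionals isolates one coefficient of each monomial of degree at
most `d`. -/
theorem exists_functional_of_linearIndepOn {p d : ℕ}
    {Δ : A →ₐ[F] A ⊗[F] A} (hΔ : ∀ i, Δ (b i) = b i ⊗ₜ 1 + 1 ⊗ₜ b i)
    (hli : LinearIndepOn F (mon b) {s | IsTruncated p s ∧ s.card < d})
    {i : I} {t : Multiset I} (ht : t ≠ 0) (htr : IsTruncated p (i ::ₘ t)) (htd : t.card < d) :
    ∃ f : A →ₗ[F] F, ∀ s, IsTruncated p s → s.card ≤ d →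
      f (mon b s) = if s = i ::ₘ t then (s.count i : F) else 0 := by
  have hd : 1 < d := lt_of_le_of_lt (Multiset.card_pos.mpr ht) htd
  obtain ⟨f, hf⟩ := hli.exists_dual (i := {i})
    ⟨htr.mono (by simp), by simpa using hd⟩
  obtain ⟨g, hg⟩ := hli.exists_dual (i := t) ⟨htr.mono (Multiset.le_cons_self t i), htd⟩
  refine ⟨LinearMap.mul' F F ∘ₗ TensorProduct.map f g ∘ₗ Δ.toLinearMap, fun s hs hsd => ?_⟩
  have h0 : IsTruncated p (0 : Multiset I) := hs.mono (Multiset.zero_le s)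
  have key : (LinearMap.mul' F F ∘ₗ TensorProduct.map f g ∘ₗ Δ.toLinearMap) (mon b s)
      = (s.antidiagonal.map fun x =>
          (if x.1 = {i} then 1 else 0) * (if x.2 = t then (1 : F) else 0)).sum := by
    simp only [LinearMap.comp_apply, AlgHom.toLinearMap_apply, comul_mon hΔ, map_multiset_sum,
      Multiset.map_map, Function.comp_def, TensorProduct.map_tmul, LinearMap.mul'_apply]
    congr 1
    refine Multiset.map_congr rfl fun x hx => ?_
    rw [Multiset.mem_antidiagonal] at hx
    have hc : x.1.card + x.2.card = s.card := by rw [← hx, Multiset.card_add]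
    have h1 : IsTruncated p x.1 := hs.mono (hx ▸ Multiset.le_add_right _ _)
    have h2 : IsTruncated p x.2 := hs.mono (hx ▸ Multiset.le_add_left _ _)
    by_cases e2 : x.2 = 0
    · have := hg 0 ⟨h0, by simp; omega⟩
      rw [e2, this]; simp [Ne.symm ht]
    by_cases e1 : x.1 = 0
    · have := hf 0 ⟨h0, by simp; omega⟩
      rw [e1, this]; simp
    have c1 := Multiset.card_pos.mpr e1
    have c2 := Multiset.card_pos.mpr e2
    rw [hf x.1 ⟨h1, by omega⟩, hg x.2 ⟨h2, by omega⟩]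
  rw [key, Multiset.sum_antidiagonal_fst_eq_singleton i s fun u => if u = t then (1 : F) else 0]
  by_cases his : i ∈ s
  · have : s.erase i = t ↔ s = i ::ₘ t := by
      constructor
      · rintro rfl; exact (Multiset.cons_erase his).symm
      · rintro rfl; simp
    simp [this]
  · have : s ≠ i ::ₘ t := by rintro rfl; simp at his
    simp [this, Multiset.count_eq_zero_of_notMem his]

theorem linearIndepOn_mon_card_le_one {ε : A →ₐ[F] F} (hε : ∀ i, ε (b i) = 0)
    (hb : LinearIndependent F b) :
    LinearIndepOn F (mon b) {s : Multiset I | s.card ≤ 1} := by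
  have hins : {s : Multiset I | s.card ≤ 1}
      = insert 0 (Set.range fun i : I => ({i} : Multiset I)) := by
    ext s
    have : s.card ≤ 1 ↔ s.card = 0 ∨ s.card = 1 := by omega
    simp [this, Multiset.card_eq_one, eq_comm]
  rw [hins, linearIndepOn_insert (by simp)]
  constructor
  · rw [linearIndepOn_range_iff fun i j h => Multiset.singleton_inj.mp h]
    simpa [Function.comp_def] using hb
  · intro h
    have hle : Submodule.span F (mon b '' Set.range fun i : I => ({i} : Multiset I))
        ≤ LinearMap.ker ε.toLinearMap := by
      rw [Submodule.span_le]
      rintro _ ⟨_, ⟨i, rfl⟩, rfl⟩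
      simp [hε]
    simpa using hle h

theorem linearIndepOn_mon_card_lt {p : ℕ} [CharP F p]
    {Δ : A →ₐ[F] A ⊗[F] A} (hΔ : ∀ i, Δ (b i) = b i ⊗ₜ 1 + 1 ⊗ₜ b i)
    {ε : A →ₐ[F] F} (hε : ∀ i, ε (b i) = 0) (hb : LinearIndependent F b) (d : ℕ) :
    LinearIndepOn F (mon b) {s | IsTruncated p s ∧ s.card < d} := by
  induction d with
  | zero => simp
  | succ d ih =>
    rw [linearIndepOn_iff']
    intro T c hT hsum
    have hbig : ∀ s ∈ T, 1 < s.card → c s = 0 := by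
      intro s hs hs1
      obtain ⟨i, t, rfl⟩ : ∃ i t, s = i ::ₘ t := by
        obtain ⟨i, hi⟩ := Multiset.card_pos_iff_exists_mem.mp (zero_lt_one.trans hs1)
        exact ⟨i, Multiset.exists_cons_of_mem hi⟩
      have hsT := hT hs
      simp only [Set.mem_ofPred_eq, Multiset.card_cons] at hsT hs1
      obtain ⟨f, hf⟩ := exists_functional_of_linearIndepOn hΔ ih
        (Multiset.card_pos.mp (by omega : 0 < t.card)) hsT.1 (by omega)
      have h := congrArg f hsum
      rw [map_sum, map_zero, Finset.sum_eq_single_of_mem _ hs] at h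
      · rw [map_smul, hf _ hsT.1 (by simpa using Nat.lt_succ_iff.mp hsT.2), if_pos rfl,
          smul_eq_mul] at h
        refine (mul_eq_zero.mp h).resolve_right fun h0 => ?_
        rw [CharP.cast_eq_zero_iff F p] at h0
        exact (Nat.le_of_dvd (by simp) h0).not_gt (hsT.1 i)
      · intro u hu hne
        rw [map_smul, hf u (hT hu).1 (Nat.lt_succ_iff.mp (hT hu).2), if_neg hne, smul_zero]
    have hsmall : ∑ s ∈ T with s.card ≤ 1, c s • mon b s = 0 := by
      rw [← hsum]
      refine Finset.sum_subset (Finset.filter_subset _ _) fun s hs hs' => ?_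
      rw [hbig s hs (by simpa [hs] using hs'), zero_smul]
    intro s hs
    by_cases h1 : s.card ≤ 1
    · have hone := linearIndepOn_mon_card_le_one hε hb
      rw [linearIndepOn_iff'] at hone
      exact hone {s ∈ T | s.card ≤ 1} c (fun u hu => (Finset.mem_filter.mp hu).2) hsmall s
        (Finset.mem_filter.mpr ⟨hs, h1⟩)
    · exact hbig s hs (by omega)

theorem linearIndepOn_mon {p : ℕ} [CharP F p]
    {Δ : A →ₐ[F] A ⊗[F] A} (hΔ : ∀ i, Δ (b i) = b i ⊗ₜ 1 + 1 ⊗ₜ b i)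
    {ε : A →ₐ[F] F} (hε : ∀ i, ε (b i) = 0) (hb : LinearIndependent F b) :
    LinearIndepOn F (mon b) {s | IsTruncated p s} := by
  rw [linearIndepOn_iff']
  intro T c hT
  refine linearIndepOn_iff'.mp
    (linearIndepOn_mon_card_lt hΔ hε hb (T.sup Multiset.card + 1)) T c fun s hs => ⟨hT hs, ?_⟩
  exact Nat.lt_succ_iff.mpr (Finset.le_sup (f := Multiset.card) hs)

end Independence

section Spanning

variable {p n : ℕ} {b : I → A} {w : I → ℕ}

/-- The span of the products of basis elements that are shorter than `l` and whose weight is at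
least the weight of `l` truncated at `n`. -/
def lowerSpan (F : Type*) [Field F] [Algebra F A] (b : I → A) (w : I → ℕ) (n : ℕ) (l : List I) :
    Submodule F A :=
  Submodule.span F
    ((fun t : List I => (t.map b).prod) ''
      {t | t.length < l.length ∧ min n (l.map w).sum ≤ (t.map w).sum})

theorem mul_prod_mem_lowerSpan {x : A} {k : ℕ} {l t : List I}
    (hx : x ∈ Submodule.span F (b '' {c | min n k ≤ w c}))
    (hlen : t.length + 1 < l.length) (hw : (l.map w).sum = k + (t.map w).sum) :
    x * (t.map b).prod ∈ lowerSpan F b w n l := by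
  induction hx using Submodule.span_induction with
  | mem x hx =>
    obtain ⟨c, hc, rfl⟩ := hx
    refine Submodule.subset_span ⟨c :: t, ⟨by simpa using hlen, ?_⟩, by simp⟩
    simp only [Set.mem_ofPred_eq] at hc
    simp only [List.map_cons, List.sum_cons]
    omega
  | zero => simp
  | add x y _ _ hx hy => rw [add_mul]; exact add_mem hx hy
  | smul a x _ hx => rw [smul_mul_assoc]; exact Submodule.smul_mem _ _ hx

theorem prod_sub_prod_mem_lowerSpan
    (hbr : ∀ i j, b i * b j - b j * b i ∈ Submodule.span F (b '' {c | min n (w i + w j) ≤ w c}))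
    {l l' : List I} (h : l.Perm l') :
    (l.map b).prod - (l'.map b).prod ∈ lowerSpan F b w n l := by
  induction h with
  | nil => simp
  | @cons a l l' _ ih =>
    simp only [List.map_cons, List.prod_cons, ← mul_sub]
    generalize (l.map b).prod - (l'.map b).prod = x at ih
    induction ih using Submodule.span_induction with
    | mem x hx =>
      obtain ⟨t, ⟨ht, htw⟩, rfl⟩ := hx
      refine Submodule.subset_span ⟨a :: t, ⟨by simpa using ht, ?_⟩, by simp⟩
      simp only [List.map_cons, List.sum_cons]
      omega
    | zero => simp
    | add x y _ _ hx hy => rw [mul_add]; exact add_mem hx hy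
    | smul a x _ hx => rw [mul_smul_comm]; exact Submodule.smul_mem _ _ hx
  | swap i j l =>
    have := mul_prod_mem_lowerSpan (l := j :: i :: l) (t := l) (hbr j i) (by simp)
      (by simp [add_assoc])
    simpa [sub_mul, mul_assoc] using this
  | @trans l₁ l₂ l₃ h₁ _ ih₁ ih₂ =>
    have : lowerSpan F b w n l₁ = lowerSpan F b w n l₂ := by
      simp only [lowerSpan, h₁.length_eq, (h₁.map w).sum_eq]
    rw [← sub_add_sub_cancel _ (l₂.map b).prod]
    exact add_mem ih₁ (this ▸ ih₂)

theorem prod_mem_span_mon [LinearOrder I] (hp : 1 < p)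
    (hbr : ∀ i j, b i * b j - b j * b i ∈ Submodule.span F (b '' {c | min n (w i + w j) ≤ w c}))
    (hpow : ∀ i, b i ^ p ∈ Submodule.span F (b '' {c | min n (p * w i) ≤ w c}))
    (l : List I) (hl : n ≤ (l.map w).sum) :
    (l.map b).prod ∈
      Submodule.span F (mon b '' {s | IsTruncated p s ∧ n ≤ (s.map w).sum}) := by
  induction hlen : l.length using Nat.strong_induction_on generalizing l with
  | _ m ih =>
    subst hlen
    have hlow : lowerSpan F b w n l ≤
        Submodule.span F (mon b '' {s | IsTruncated p s ∧ n ≤ (s.map w).sum}) := by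
      refine Submodule.span_le.mpr ?_
      rintro _ ⟨t, ⟨ht, htw⟩, rfl⟩
      exact ih _ ht t (by omega) rfl
    by_cases htr : IsTruncated p (l : Multiset I)
    · have hperm : l.Perm (Multiset.sort (l : Multiset I)) := by
        rw [← Multiset.coe_eq_coe, Multiset.sort_eq]
      rw [← sub_add_cancel (l.map b).prod ((Multiset.sort (l : Multiset I)).map b).prod]
      exact add_mem (hlow (prod_sub_prod_mem_lowerSpan hbr hperm))
        (Submodule.subset_span ⟨l, ⟨htr, by simpa using hl⟩, rfl⟩)
    · obtain ⟨i, hi⟩ : ∃ i, p ≤ l.count i := by simpa [IsTruncated] using htr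
      obtain ⟨t, ht⟩ : ∃ t : List I, l.Perm (List.replicate p i ++ t) := by
        have := Multiset.le_count_iff_replicate_le.mp
          (by simpa using hi : p ≤ (l : Multiset I).count i)
        obtain ⟨u, hu⟩ := Multiset.le_iff_exists_add.mp this
        refine ⟨u.toList, ?_⟩
        rw [← Multiset.coe_eq_coe, hu, ← Multiset.coe_add, Multiset.coe_toList,
          Multiset.coe_replicate]
      rw [← sub_add_cancel (l.map b).prod ((List.replicate p i ++ t).map b).prod]
      refine add_mem (hlow (prod_sub_prod_mem_lowerSpan hbr ht)) (hlow ?_)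
      have := mul_prod_mem_lowerSpan (l := l) (t := t) (hpow i)
        (by rw [ht.length_eq]; simp; omega) (by rw [(ht.map w).sum_eq]; simp)
      simpa using this

theorem pow_ker_le_span_prod {ε : A →ₐ[F] F} (hε : ∀ i, ε (b i) = 0)
    (hgen : Algebra.adjoin F (Set.range b) = ⊤) (hw : ∀ i, 1 ≤ w i) (k : ℕ) :
    LinearMap.ker ε.toLinearMap ^ k ≤
      Submodule.span F ((fun t : List I => (t.map b).prod) '' {t | k ≤ (t.map w).sum}) := by
  have hker : LinearMap.ker ε.toLinearMap ≤
      Submodule.span F ((fun t : List I => (t.map b).prod) '' {t | 1 ≤ (t.map w).sum}) := by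
    set N := Submodule.span F ((fun t : List I => (t.map b).prod) '' {t | 1 ≤ (t.map w).sum})
    have hN : N ≤ LinearMap.ker ε.toLinearMap := by
      refine Submodule.span_le.mpr ?_
      rintro _ ⟨t, ht, rfl⟩
      cases t with
      | nil => simp at ht
      | cons a t => simp [hε]
    have htop : (⊤ : Submodule F A) ≤ Submodule.span F {1} ⊔ N := by
      rw [← Algebra.top_toSubmodule, ← hgen, Algebra.adjoin_eq_span, Submodule.span_le]
      intro x hx
      obtain ⟨l, hl, rfl⟩ := Submonoid.exists_list_of_mem_closure hx
      obtain ⟨t, rfl⟩ : ∃ t : List I, t.map b = l := by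
        rw [← Set.mem_range, Set.range_list_map]
        exact hl
      cases t with
      | nil => exact Submodule.mem_sup_left (Submodule.subset_span (by simp))
      | cons a t =>
        refine Submodule.mem_sup_right (Submodule.subset_span ⟨a :: t, ?_, rfl⟩)
        have := hw a
        simp only [Set.mem_ofPred_eq, List.map_cons, List.sum_cons]
        omega
    intro x hx
    obtain ⟨y, hy, z, hz, rfl⟩ := Submodule.mem_sup.mp (htop (Submodule.mem_top (x := x)))
    obtain ⟨a, rfl⟩ := Submodule.mem_span_singleton.mp hy
    have hz' := hN hz
    rw [LinearMap.mem_ker, AlgHom.toLinearMap_apply] at hx hz'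
    have ha : a = 0 := by simpa [hz'] using hx
    simpa [ha] using hz
  induction k with
  | zero =>
    rw [pow_zero, Submodule.one_eq_span, Submodule.span_le]
    rintro _ rfl
    exact Submodule.subset_span ⟨[], by simp, by simp⟩
  | succ k ih =>
    rw [pow_succ]
    refine (mul_le_mul' ih hker).trans ?_
    rw [Submodule.span_mul_span]
    refine Submodule.span_mono ?_
    rintro _ ⟨_, ⟨s, hs, rfl⟩, _, ⟨t, ht, rfl⟩, rfl⟩
    refine ⟨s ++ t, ?_, by simp⟩
    simp only [Set.mem_ofPred_eq, List.map_append, List.sum_append] at *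
    omega

/-- An element of the span of `b` lying in the `n`-th power of the augmentation ideal is a
combination of elements of weight at least `n`. -/
theorem mem_span_of_mem_pow_ker [LinearOrder I] [CharP F p] (hp : 1 < p)
    {Δ : A →ₐ[F] A ⊗[F] A} (hΔ : ∀ i, Δ (b i) = b i ⊗ₜ 1 + 1 ⊗ₜ b i)
    {ε : A →ₐ[F] F} (hε : ∀ i, ε (b i) = 0) (hb : LinearIndependent F b)
    (hgen : Algebra.adjoin F (Set.range b) = ⊤) (hw : ∀ i, 1 ≤ w i)
    (hbr : ∀ i j, b i * b j - b j * b i ∈ Submodule.span F (b '' {c | min n (w i + w j) ≤ w c}))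
    (hpow : ∀ i, b i ^ p ∈ Submodule.span F (b '' {c | min n (p * w i) ≤ w c}))
    {x : A} (hx : x ∈ Submodule.span F (Set.range b))
    (hxn : x ∈ LinearMap.ker ε.toLinearMap ^ n) :
    x ∈ Submodule.span F (b '' {c | n ≤ w c}) := by
  obtain ⟨a, rfl⟩ := (Finsupp.mem_span_range_iff_exists_finsupp).mp hx
  refine Submodule.sum_mem _ fun i hi => Submodule.smul_mem _ _ (Submodule.subset_span ⟨i, ?_, rfl⟩)
  by_contra hni
  have htr : ∀ j : I, IsTruncated p ({j} : Multiset I) := fun j k =>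
    ((Multiset.count_le_card k _).trans (by simp)).trans_lt hp
  obtain ⟨f, hf⟩ := (linearIndepOn_mon hΔ hε hb).exists_dual (i := {i}) (htr i)
  have hfx : (a.sum fun j c => c • b j) ∈ LinearMap.ker f := by
    refine (?_ : LinearMap.ker ε.toLinearMap ^ n ≤ LinearMap.ker f) hxn
    refine (pow_ker_le_span_prod hε hgen hw n).trans (Submodule.span_le.mpr ?_)
    rintro _ ⟨t, ht, rfl⟩
    refine (Submodule.span_le.mpr ?_ : _ ≤ LinearMap.ker f) (prod_mem_span_mon hp hbr hpow t ht)
    rintro _ ⟨s, ⟨hs, hsn⟩, rfl⟩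
    rw [SetLike.mem_coe, LinearMap.mem_ker, hf s hs, if_neg]
    rintro rfl
    exact hni (by simpa using hsn)
  have hfb : ∀ j, f (b j) = if j = i then 1 else 0 := fun j => by
    simpa using hf {j} (htr j)
  rw [LinearMap.mem_ker, Finsupp.sum, map_sum] at hfx
  have hai : a i = 0 := by simpa [hfb] using hfx
  simp [hai] at hi

end Spanning

end OrderedMonomial

/-- A finite initial segment of an increasing sequence of subspaces has an adapted basis. -/
theorem exists_adapted_basis {F A : Type*} [Field F] [AddCommGroup A] [Module F A]
    {G : ℕ → Submodule F A} (hG : Monotone G) (N : ℕ) :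
    ∃ B : Set A, LinearIndepOn F id B ∧ B ⊆ G N ∧
      ∀ j ≤ N, G j ≤ Submodule.span F (B ∩ G j) := by
  induction N with
  | zero =>
    obtain ⟨B, hB, -, hsp, hli⟩ := exists_linearIndepOn_id_extension
      (linearIndependent_empty F A) (Set.empty_subset (G 0 : Set A))
    refine ⟨B, hli, hB, fun j hj => ?_⟩
    rw [Nat.le_zero.mp hj, Set.inter_eq_left.mpr hB]
    exact hsp
  | succ N ih =>
    obtain ⟨B, hli, hBG, hBsp⟩ := ih
    obtain ⟨C, hC, hBC, hsp, hliC⟩ := exists_linearIndepOn_id_extension hli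
      (hBG.trans (hG N.le_succ))
    refine ⟨C, hliC, hC, fun j hj => ?_⟩
    rcases Nat.le_succ_iff.mp hj with hj | rfl
    · exact (hBsp j hj).trans (Submodule.span_mono (Set.inter_subset_inter_left _ hBC))
    · rw [Set.inter_eq_left.mpr hC]
      exact hsp

/-- If a primitively generated algebra is generated by a subspace `V` of primitive elements, then
any filtration `E` of `V` compatible with commutators and `p`-th powers contains the filtration
induced by the powers of the augmentation ideal. -/
theorem inf_pow_ker_le_of_filtration {F A : Type*} [Field F] [Ring A] [Algebra F A] {p : ℕ}
    [CharP F p] (hp : 1 < p) {V : Submodule F A}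
    {Δ : A →ₐ[F] A ⊗[F] A} (hΔ : ∀ x ∈ V, Δ x = x ⊗ₜ 1 + 1 ⊗ₜ x)
    {ε : A →ₐ[F] F} (hε : ∀ x ∈ V, ε x = 0) (hgen : Algebra.adjoin F (V : Set A) = ⊤)
    {E : ℕ → Submodule F A} (hE₁ : E 1 = V) (hE : ∀ i, 1 ≤ i → E (i + 1) ≤ E i)
    (hbr : ∀ i j, 1 ≤ i → 1 ≤ j → ∀ x ∈ E i, ∀ y ∈ E j, x * y - y * x ∈ E (i + j))
    (hpow : ∀ i, 1 ≤ i → ∀ x ∈ E i, x ^ p ∈ E (p * i)) {n : ℕ} (hn : 1 ≤ n) :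
    V ⊓ LinearMap.ker ε.toLinearMap ^ n ≤ E n := by
  classical
  have hanti : ∀ i j, 1 ≤ i → i ≤ j → E j ≤ E i := by
    intro i j hi hij
    induction j, hij using Nat.le_induction with
    | base => exact le_rfl
    | succ j hj ih => exact (hE j (hi.trans hj)).trans ih
  obtain ⟨B, hli, hBV, hBsp⟩ := exists_adapted_basis (G := fun j => E (max 1 (n - j)))
    (fun i j hij => hanti _ _ (by omega) (by omega)) n
  have hBE : ∀ k, 1 ≤ k → k ≤ n → E k ≤ Submodule.span F (B ∩ E k) := by
    intro k hk hkn
    have := hBsp (n - k) (by omega)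
    rwa [show max 1 (n - (n - k)) = k by omega] at this
  simp only [Nat.sub_self, zero_le, sup_of_le_left, hE₁] at hBV
  let w : B → ℕ := fun x => Nat.findGreatest (fun k => (x : A) ∈ E k) n
  have hwle : ∀ x, w x ≤ n := fun x => Nat.findGreatest_le n
  have hle_w : ∀ (x : B) k, k ≤ n → (x : A) ∈ E k → k ≤ w x := fun x k hk hx =>
    Nat.le_findGreatest hk hx
  have hB1 : ∀ x : B, (x : A) ∈ E 1 := fun x => hE₁ ▸ hBV x.2
  have hw1 : ∀ x, 1 ≤ w x := fun x => hle_w x 1 hn (hB1 x)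
  have hwE : ∀ x : B, (x : A) ∈ E (w x) := fun x =>
    Nat.findGreatest_spec (P := fun k => (x : A) ∈ E k) hn (hB1 x)
  have hspan : ∀ k, 1 ≤ k →
      E k ≤ Submodule.span F ((fun x : B => (x : A)) '' {c | min n k ≤ w c}) := by
    intro k hk
    refine (hanti (min n k) k (by omega) (min_le_right _ _)).trans
      ((hBE _ (by omega) (min_le_left _ _)).trans (Submodule.span_mono ?_))
    rintro x ⟨hxB, hxE⟩
    exact ⟨⟨x, hxB⟩, hle_w ⟨x, hxB⟩ _ (min_le_left _ _) hxE, rfl⟩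
  have hVB : Submodule.span F (Set.range fun x : B => (x : A)) = V := by
    rw [Subtype.range_coe]
    refine le_antisymm (Submodule.span_le.mpr hBV) (hE₁ ▸ (hBE 1 le_rfl hn).trans ?_)
    exact Submodule.span_mono Set.inter_subset_left
  let : LinearOrder B := linearOrderOfSTO WellOrderingRel
  rintro x ⟨hxV, hxn⟩
  have := OrderedMonomial.mem_span_of_mem_pow_ker (b := fun x : B => (x : A)) (w := w) (n := n)
    hp (fun i => hΔ _ (hBV i.2)) (fun i => hε _ (hBV i.2)) hli
    (by rw [← Algebra.adjoin_span, hVB, hgen]) hw1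
    (fun i j => hspan _ (by have := hw1 i; omega)
      (hbr _ _ (hw1 i) (hw1 j) _ (hwE i) _ (hwE j)))
    (fun i => hspan _ (Nat.mul_pos (by omega) (hw1 i)) (hpow _ (hw1 i) _ (hwE i)))
    (hVB ▸ hxV) hxn
  refine Submodule.span_le.mpr ?_ this
  rintro _ ⟨c, hc, rfl⟩
  have hcn : w c = n := le_antisymm (hwle c) hc
  exact hcn ▸ hwE c

/-- The elements of degree `n` in the restricted Lie algebra generated by `W` modulo `W ^ 2`
inside the graded algebra of the powers of `W`, lifted to `W ^ n`. -/
inductive IsLieOfDegree (p : ℕ) {F A : Type*} [Field F] [Ring A] [Algebra F A]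
    (W : Submodule F A) : ℕ → A → Prop
  | one {x : A} : x ∈ W → IsLieOfDegree p W 1 x
  | tail {n : ℕ} {x : A} : 1 ≤ n → x ∈ W ^ (n + 1) → IsLieOfDegree p W n x
  | add {n : ℕ} {x y : A} : IsLieOfDegree p W n x → IsLieOfDegree p W n y →
      IsLieOfDegree p W n (x + y)
  | smul {n : ℕ} (a : F) {x : A} : IsLieOfDegree p W n x → IsLieOfDegree p W n (a • x)
  | commutator {i j : ℕ} {x y : A} : IsLieOfDegree p W i x → IsLieOfDegree p W j y →
      IsLieOfDegree p W (i + j) (x * y - y * x)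
  | pow {i : ℕ} {x : A} : IsLieOfDegree p W i x → IsLieOfDegree p W (p * i) (x ^ p)

namespace IsLieOfDegree

variable {p : ℕ} {F A : Type*} [Field F] [Ring A] [Algebra F A] {W : Submodule F A}

theorem map {A' : Type*} [Ring A'] [Algebra F A'] (φ : A →ₐ[F] A') {n : ℕ} {x : A}
    (h : IsLieOfDegree p W n x) : IsLieOfDegree p (W.map φ.toLinearMap) n (φ x) := by
  induction h with
  | one hx => exact .one ⟨_, hx, rfl⟩
  | tail hn hx => exact .tail hn (Submodule.map_pow W φ _ ▸ ⟨_, hx, rfl⟩)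
  | add _ _ hx hy => rw [map_add]; exact hx.add hy
  | smul a _ hx => rw [map_smul]; exact hx.smul a
  | commutator _ _ hx hy => rw [map_sub, map_mul, map_mul]; exact hx.commutator hy
  | pow _ hx => rw [map_pow]; exact hx.pow

variable (p W) in
/-- `IsLieOfDegree p W n` as a subspace, for `n ≥ 1`. -/
def submodule (n : ℕ) (hn : 1 ≤ n) : Submodule F A where
  carrier := {x | IsLieOfDegree p W n x}
  add_mem' := .add
  zero_mem' := .tail hn (zero_mem _)
  smul_mem' a _ := .smul a

theorem mem_submodule {n : ℕ} (hn : 1 ≤ n) {x : A} :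
    x ∈ submodule p W n hn ↔ IsLieOfDegree p W n x := Iff.rfl

end IsLieOfDegree

section Augmentation

variable {p : ℕ} {F A : Type*} [Field F] [Ring A] [Algebra F A] {W V : Submodule F A}

theorem pow_succ_le_pow_of_mul_le (hW : W * W ≤ W) {i : ℕ} (hi : 1 ≤ i) : W ^ (i + 1) ≤ W ^ i := by
  obtain ⟨k, rfl⟩ := Nat.exists_eq_add_of_le' hi
  rw [pow_succ, pow_succ, mul_assoc]
  exact mul_le_mul_right hW _

theorem add_pow_sub_pow_mem (hW : W * W ≤ W) {i : ℕ} (hi : 1 ≤ i) {d v : A} (hd : d ∈ W ^ i)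
    (hv : v ∈ W ^ (i + 1)) (k : ℕ) : (d + v) ^ k - d ^ k ∈ W ^ (i * k + 1) := by
  induction k with
  | zero => simp
  | succ k ih =>
    have hdv : d + v ∈ W ^ i := add_mem hd (pow_succ_le_pow_of_mul_le hW hi hv)
    have e : (d + v) ^ (k + 1) - d ^ (k + 1) = ((d + v) ^ k - d ^ k) * (d + v) + d ^ k * v := by
      rw [pow_succ, pow_succ]; noncomm_ring
    have hdk : d ^ k ∈ W ^ (i * k) := by rw [pow_mul]; exact Submodule.pow_mem_pow _ hd k
    rw [e]
    refine add_mem ?_ ?_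
    · have := Submodule.mul_mem_mul ih hdv
      rwa [← pow_add, show i * k + 1 + i = i * (k + 1) + 1 by ring] at this
    · have := Submodule.mul_mem_mul hdk hv
      rwa [← pow_add, show i * k + (i + 1) = i * (k + 1) + 1 by ring] at this

theorem IsLieOfDegree.one_le_and_mem (hp : 1 < p) (hW : W * W ≤ W) (hVW : W ≤ V ⊔ W ^ 2)
    (hV : V ≤ W)
    (hbr : ∀ x ∈ V, ∀ y ∈ V, x * y - y * x ∈ V) (hpow : ∀ x ∈ V, x ^ p ∈ V)
    {n : ℕ} {x : A} (h : IsLieOfDegree p W n x) :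
    1 ≤ n ∧ x ∈ (V ⊓ W ^ n) ⊔ W ^ (n + 1) := by
  induction h with
  | one hx => exact ⟨le_rfl, by rw [pow_one, inf_eq_left.mpr hV]; exact hVW hx⟩
  | tail hn hx => exact ⟨hn, Submodule.mem_sup_right hx⟩
  | add _ _ hx hy => exact ⟨hx.1, add_mem hx.2 hy.2⟩
  | smul a _ hx => exact ⟨hx.1, Submodule.smul_mem _ a hx.2⟩
  | @commutator i j x y _ _ hx hy =>
    refine ⟨by omega, ?_⟩
    obtain ⟨d, ⟨hdV, hdW⟩, v, hv, rfl⟩ := Submodule.mem_sup.mp hx.2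
    obtain ⟨d', ⟨hdV', hdW'⟩, v', hv', rfl⟩ := Submodule.mem_sup.mp hy.2
    have hdv' := add_mem hdW' (pow_succ_le_pow_of_mul_le hW hy.1 hv')
    have e : (d + v) * (d' + v') - (d' + v') * (d + v) = (d * d' - d' * d)
        + (v * (d' + v') - (d' + v') * v + (d * v' - v' * d)) := by noncomm_ring
    have hmem : ∀ {k l : ℕ} {a b : A}, a ∈ W ^ k → b ∈ W ^ l → a * b - b * a ∈ W ^ (k + l) := by
      intro k l a b ha hb
      refine sub_mem (pow_add W k l ▸ Submodule.mul_mem_mul ha hb) ?_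
      rw [add_comm, pow_add]
      exact Submodule.mul_mem_mul hb ha
    rw [e]
    refine Submodule.add_mem_sup ⟨hbr _ hdV _ hdV', hmem (k := i) hdW hdW'⟩ (add_mem ?_ ?_)
    · have := hmem hv hdv'
      rwa [show i + 1 + j = i + j + 1 by ring] at this
    · exact hmem (k := i) hdW hv'
  | @pow i x _ hx =>
    refine ⟨Nat.mul_pos (by omega) hx.1, ?_⟩
    obtain ⟨d, ⟨hdV, hdW⟩, v, hv, rfl⟩ := Submodule.mem_sup.mp hx.2
    rw [← add_sub_cancel (d ^ p) ((d + v) ^ p), mul_comm p i]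
    exact Submodule.add_mem_sup
      ⟨hpow d hdV, pow_mul W i p ▸ Submodule.pow_mem_pow _ hdW p⟩
      (add_pow_sub_pow_mem hW hx.1 hdW hv p)

theorem mem_inf_pow_sup_iff_isLieOfDegree [CharP F p] (hp : 1 < p)
    {Δ : A →ₐ[F] A ⊗[F] A} (hΔ : ∀ x ∈ V, Δ x = x ⊗ₜ 1 + 1 ⊗ₜ x)
    {ε : A →ₐ[F] F} (hε : ∀ x ∈ V, ε x = 0) (hgen : Algebra.adjoin F (V : Set A) = ⊤)
    (hbr : ∀ x ∈ V, ∀ y ∈ V, x * y - y * x ∈ V) (hpow : ∀ x ∈ V, x ^ p ∈ V)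
    {n : ℕ} (hn : 1 ≤ n) {x : A} :
    x ∈ (V ⊓ LinearMap.ker ε.toLinearMap ^ n) ⊔ LinearMap.ker ε.toLinearMap ^ (n + 1) ↔
      IsLieOfDegree p (LinearMap.ker ε.toLinearMap) n x := by
  set W := LinearMap.ker ε.toLinearMap
  have hWmem : ∀ {x}, x ∈ W ↔ ε x = 0 := Iff.rfl
  have hV : V ≤ W := hε
  have hW : W * W ≤ W := Submodule.mul_le.mpr fun x hx y hy => by
    rw [hWmem] at *; rw [map_mul, hx, zero_mul]
  have hle : V ⊔ W ^ 2 ≤ W := sup_le hV (by rw [pow_two]; exact hW)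
  have hVW : W ≤ V ⊔ W ^ 2 := by
    have htop : ∀ x : A, ∃ c : F, x - algebraMap F A c ∈ V ⊔ W ^ 2 := by
      intro x
      have hx : x ∈ Algebra.adjoin F (V : Set A) := hgen ▸ Algebra.mem_top
      induction hx using Algebra.adjoin_induction with
      | mem x hx => exact ⟨0, by simpa using Submodule.mem_sup_left hx⟩
      | algebraMap r => exact ⟨r, by simp⟩
      | add x y _ _ hx hy =>
        obtain ⟨c, hc⟩ := hx
        obtain ⟨d, hd⟩ := hy
        exact ⟨c + d, by rw [map_add, add_sub_add_comm]; exact add_mem hc hd⟩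
      | mul x y _ _ hx hy =>
        obtain ⟨c, hc⟩ := hx
        obtain ⟨d, hd⟩ := hy
        refine ⟨c * d, ?_⟩
        have e : x * y - algebraMap F A (c * d) =
            (x - algebraMap F A c) * (y - algebraMap F A d) + c • (y - algebraMap F A d)
              + d • (x - algebraMap F A c) := by
          rw [Algebra.smul_def, Algebra.smul_def, Algebra.commutes d, map_mul]; noncomm_ring
        rw [e]
        refine add_mem (add_mem (Submodule.mem_sup_right ?_) (Submodule.smul_mem _ _ hd))
          (Submodule.smul_mem _ _ hc)
        rw [pow_two]
        exact Submodule.mul_mem_mul (hle hc) (hle hd)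
    intro x hx
    obtain ⟨c, hc⟩ := htop x
    have h0 := hWmem.mp (hle hc)
    rw [map_sub, hWmem.mp hx, AlgHom.commutes, zero_sub, neg_eq_zero] at h0
    rw [Algebra.algebraMap_self_apply] at h0
    simpa [h0] using hc
  have hdeg : ∀ {k : ℕ} {y : A}, IsLieOfDegree p W k y → 1 ≤ k ∧ y ∈ (V ⊓ W ^ k) ⊔ W ^ (k + 1) :=
    fun h => h.one_le_and_mem hp hW hVW hV hbr hpow
  refine ⟨fun hx => ?_, fun h => (hdeg h).2⟩
  let E : ℕ → Submodule F A := fun k =>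
    if hk : 1 ≤ k then V ⊓ IsLieOfDegree.submodule p W k hk else ⊥
  have hEmem : ∀ {k : ℕ} {y : A}, 1 ≤ k → (y ∈ E k ↔ y ∈ V ∧ IsLieOfDegree p W k y) := by
    intro k y hk
    simp only [E, dif_pos hk, Submodule.mem_inf, IsLieOfDegree.mem_submodule]
  obtain ⟨d, hd, v, hv, rfl⟩ := Submodule.mem_sup.mp hx
  refine .add ((hEmem hn).mp (inf_pow_ker_le_of_filtration (E := E) hp hΔ hε hgen ?_ ?_ ?_ ?_ hn
    hd)).2 (.tail hn hv)
  · ext y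
    rw [hEmem le_rfl]
    exact ⟨fun h => h.1, fun h => ⟨h, .one (hV h)⟩⟩
  · intro i hi y hy
    rw [hEmem (by omega)] at hy
    rw [hEmem hi]
    exact ⟨hy.1, .tail hi ((sup_le inf_le_right
      (pow_succ_le_pow_of_mul_le hW (by omega))) (hdeg hy.2).2)⟩
  · intro i j hi hj y hy z hz
    rw [hEmem hi] at hy
    rw [hEmem hj] at hz
    rw [hEmem (by omega)]
    exact ⟨hbr _ hy.1 _ hz.1, hy.2.commutator hz.2⟩
  · intro i hi y hy
    rw [hEmem hi] at hy
    rw [hEmem (Nat.mul_pos (by omega) hi)]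
    exact ⟨hpow _ hy.1, hy.2.pow⟩

end Augmentation

namespace RestrictedLieAlgebra

variable (p : ℕ) (F L : Type*) [Field F] [LieRing L] [LieAlgebra F L] [RestrictedLieAlgebra p F L]

theorem uemb_lie (x y : L) :
    uemb p F L ⁅x, y⁆ = uemb p F L x * uemb p F L y - uemb p F L y * uemb p F L x := by
  simp [uemb, LieRing.of_associative_ring_bracket]

theorem uemb_pow (x : L) : uemb p F L x ^ p = uemb p F L (pmap p F L x) := by
  have := RingQuot.mkAlgHom_rel F (s := uRel p F L) ⟨x, rfl, rfl⟩
  simpa [uemb] using this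

theorem adjoin_lSub : Algebra.adjoin F (lSub p F L : Set (uEnv p F L)) = ⊤ := by
  rw [eq_top_iff]
  rintro x -
  obtain ⟨y, rfl⟩ := RingQuot.mkAlgHom_surjective F (uRel p F L) x
  obtain ⟨z, rfl⟩ : ∃ z, UniversalEnvelopingAlgebra.mkAlgHom F L z = y :=
    Quotient.mk_surjective y
  induction z using TensorAlgebra.induction with
  | algebraMap r => simp
  | ι x => exact Algebra.subset_adjoin ⟨x, rfl⟩
  | mul a b ha hb => rw [map_mul, map_mul]; exact mul_mem ha hb
  | add a b ha hb => rw [map_add, map_add]; exact add_mem ha hb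

variable [Fact p.Prime]

theorem aug_uemb (x : L) : aug p F L (uemb p F L x) = 0 := by
  simp [aug, uemb]

theorem exists_comul [CharP F p] :
    ∃ Δ : uEnv p F L →ₐ[F] uEnv p F L ⊗[F] uEnv p F L,
      ∀ x ∈ lSub p F L, Δ x = x ⊗ₜ 1 + 1 ⊗ₜ x := by
  let f : L →ₗ⁅F⁆ uEnv p F L ⊗[F] uEnv p F L :=
    { toFun := fun x => uemb p F L x ⊗ₜ 1 + 1 ⊗ₜ uemb p F L x
      map_add' := fun x y => by
        simp only [map_add, TensorProduct.add_tmul, TensorProduct.tmul_add]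
        abel
      map_smul' := fun a x => by simp [TensorProduct.smul_tmul']
      map_lie' := fun {x y} => by
        simp [uemb_lie, LieRing.of_associative_ring_bracket, mul_add, add_mul,
          TensorProduct.sub_tmul, TensorProduct.tmul_sub]
        abel }
  have hf : ∀ x, f x = uemb p F L x ⊗ₜ 1 + 1 ⊗ₜ uemb p F L x := fun _ => rfl
  have : CharP (uEnv p F L ⊗[F] uEnv p F L) p := by
    have := ((Algebra.TensorProduct.lmul' F).comp
      (Algebra.TensorProduct.map (aug p F L) (aug p F L))).toRingHom.domain_nontrivial
    exact charP_of_injective_algebraMap (algebraMap F _).injective p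
  refine ⟨RingQuot.liftAlgHom F ⟨UniversalEnvelopingAlgebra.lift F f, ?_⟩, ?_⟩
  · rintro _ _ ⟨x, rfl, rfl⟩
    have hcomm : Commute (uemb p F L x ⊗ₜ[F] (1 : uEnv p F L)) (1 ⊗ₜ uemb p F L x) := by
      simp [Commute, SemiconjBy]
    rw [map_pow, UniversalEnvelopingAlgebra.lift_ι_apply, UniversalEnvelopingAlgebra.lift_ι_apply,
      hf, hf, add_pow_char_of_commute p hcomm, Algebra.TensorProduct.tmul_pow,
      Algebra.TensorProduct.tmul_pow, one_pow, uemb_pow]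
  · rintro _ ⟨x, rfl⟩
    rw [← hf, ← UniversalEnvelopingAlgebra.lift_ι_apply F f x]
    exact RingQuot.liftAlgHom_mkAlgHom_apply ..

theorem mem_dimension_iff_isLieOfDegree [CharP F p] {n : ℕ} (hn : 1 ≤ n) {x : uEnv p F L} :
    x ∈ (lSub p F L ⊓ (omegaIdeal p F L) ^ n) ⊔ (omegaIdeal p F L) ^ (n + 1) ↔
      IsLieOfDegree p (omegaIdeal p F L) n x := by
  obtain ⟨Δ, hΔ⟩ := exists_comul p F L
  refine mem_inf_pow_sup_iff_isLieOfDegree (Fact.out : p.Prime).one_lt hΔ ?_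
    (adjoin_lSub p F L) ?_ ?_ hn
  · rintro _ ⟨x, rfl⟩
    exact aug_uemb p F L x
  · rintro _ ⟨x, rfl⟩ _ ⟨y, rfl⟩
    exact ⟨⁅x, y⁆, uemb_lie p F L x y⟩
  · rintro _ ⟨x, rfl⟩
    exact ⟨_, (uemb_pow p F L x).symm⟩

end RestrictedLieAlgebra

open RestrictedLieAlgebra in
/-- If `φ : u(L) → u(H)` is an algebra isomorphism preserving the augmentation ideals,
then `φ(Dₙ(L) + ω(L)^{n+1}) = Dₙ(H) + ω(H)^{n+1}` for every `n ≥ 1`, where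
`Dₙ(L) = L ∩ ω(L)ⁿ` is the `n`-th dimension subalgebra. -/
theorem dimension_subalgebra_image
    (p : ℕ) (F L H : Type*) [Field F] [Fact p.Prime] [CharP F p]
    [LieRing L] [LieAlgebra F L] [RestrictedLieAlgebra p F L]
    [LieRing H] [LieAlgebra F H] [RestrictedLieAlgebra p F H]
    (φ : uEnv p F L ≃ₐ[F] uEnv p F H)
    (hω : (omegaIdeal p F L).map φ.toLinearMap = omegaIdeal p F H) :
    ∀ n : ℕ, 1 ≤ n →
      ((lSub p F L ⊓ (omegaIdeal p F L) ^ n) ⊔ (omegaIdeal p F L) ^ (n + 1)).map φ.toLinearMap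
        = (lSub p F H ⊓ (omegaIdeal p F H) ^ n) ⊔ (omegaIdeal p F H) ^ (n + 1) := by
  intro n hn
  have hω' : (omegaIdeal p F H).map φ.symm.toAlgHom.toLinearMap = omegaIdeal p F L := by
    rw [← hω, ← Submodule.map_comp]
    convert Submodule.map_id _
    ext x
    exact φ.symm_apply_apply x
  ext y
  rw [mem_dimension_iff_isLieOfDegree p F H hn]
  constructor
  · rintro ⟨x, hx, rfl⟩
    have := ((mem_dimension_iff_isLieOfDegree p F L hn).mp hx).map φ.toAlgHom
    exact hω ▸ this
  · intro hy
    refine ⟨φ.symm y, (mem_dimension_iff_isLieOfDegree p F L hn).mpr ?_, φ.apply_symm_apply y⟩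
    have := hy.map φ.symm.toAlgHom
    exact hω' ▸ this
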